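/- Classification of maximal non-closed (incomplete) quartic GPSR curves (existence and uniqueness): set U = (1/24)·(4 + (31+3√57)·(46+6√57)^{−1/3} + (100+12√57)·(46+6√57)^{−2/3}). Let h : ℝ² → ℝ be a homogeneous quartic polynomial, let p₀ ∈ ℝ² satisfy h(p₀) = 1 and det(Hess h)(p₀) < 0, and let H be the connected component of {p ∈ ℝ² : h(p) = 1 and det(Hess h)(p) < 0} containing p₀. If H is NOT closed as a subset of ℝ², then there is exactly one curve M from the following list for which there exists A ∈ GL(2,ℝ) with A(M) = H: (a) M = H_{0,K} for some K > 1/4; (b) M = H_{1,K} for some K ∈ [−25/72, U]. (Exactly one means: such M and A exist, and if M, M′ are two curves from this list each mapped onto H by some element of GL(2,ℝ), then M = M′.) -/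

import Mathlib

/-!
Common definitions: the quartic polynomial `hLK L K (x,y) = x⁴ − x²y² + L·x·y³ + K·y⁴` on ℝ²,
the Hessian determinant of a function on ℝ², and the curve `Hcurve L K = H_{L,K}`,
the connected component containing (1,0) of the hyperbolic points on the level set {h = 1}.
-/

noncomputable section
open Matrix

/-- `h_{L,K}(x,y) = x⁴ − x²y² + L·x·y³ + K·y⁴`. -/
def hLK (L K : ℝ) (v : Fin 2 → ℝ) : ℝ :=
  v 0 ^ 4 - v 0 ^ 2 * v 1 ^ 2 + L * v 0 * v 1 ^ 3 + K * v 1 ^ 4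

/-- Determinant of the Hessian matrix of `f : ℝ² → ℝ` at `p`. -/
def hessDet2 (f : (Fin 2 → ℝ) → ℝ) (p : Fin 2 → ℝ) : ℝ :=
  Matrix.det (Matrix.of fun i j : Fin 2 =>
    iteratedFDeriv ℝ 2 f p ![Pi.single i 1, Pi.single j 1])

/-- `H_{L,K}`: the connected component containing `(1,0)` of
`{p ∈ ℝ² : h_{L,K}(p) = 1 and p is a hyperbolic point of h_{L,K}}`. -/
def Hcurve (L K : ℝ) : Set (Fin 2 → ℝ) :=
  connectedComponentIn {p | hLK L K p = 1 ∧ hessDet2 (hLK L K) p < 0} ![1, 0]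

/-- The constant `U` of Theorem 3.2. -/
def Uconst : ℝ :=
  (1/24) * (4 + (31 + 3 * Real.sqrt 57) * (46 + 6 * Real.sqrt 57) ^ (-(1:ℝ)/3) +
    (100 + 12 * Real.sqrt 57) * (46 + 6 * Real.sqrt 57) ^ (-(2:ℝ)/3))

/-- The binary quartic form `a x⁴ + b x³ y + c x² y² + d x y³ + e y⁴`. -/
@[ext]
structure BinaryQuartic where
  /-- the coefficient of `x⁴` -/
  a : ℝ
  /-- the coefficient of `x³ y` -/
  b : ℝ
  /-- the coefficient of `x² y²` -/
  c : ℝ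
  /-- the coefficient of `x y³` -/
  d : ℝ
  /-- the coefficient of `y⁴` -/
  e : ℝ

namespace BinaryQuartic

/-- Evaluation of a binary quartic form. -/
def eval (Q : BinaryQuartic) (v : Fin 2 → ℝ) : ℝ :=
  Q.a * v 0 ^ 4 + Q.b * v 0 ^ 3 * v 1 + Q.c * v 0 ^ 2 * v 1 ^ 2 + Q.d * v 0 * v 1 ^ 3 +
    Q.e * v 1 ^ 4

/-- The partial derivative in the first variable. -/
def dx (Q : BinaryQuartic) (v : Fin 2 → ℝ) : ℝ :=
  4 * Q.a * v 0 ^ 3 + 3 * Q.b * v 0 ^ 2 * v 1 + 2 * Q.c * v 0 * v 1 ^ 2 + Q.d * v 1 ^ 3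

/-- The partial derivative in the second variable. -/
def dy (Q : BinaryQuartic) (v : Fin 2 → ℝ) : ℝ :=
  Q.b * v 0 ^ 3 + 2 * Q.c * v 0 ^ 2 * v 1 + 3 * Q.d * v 0 * v 1 ^ 2 + 4 * Q.e * v 1 ^ 3

/-- The Hessian determinant of a binary quartic form. -/
def hess (Q : BinaryQuartic) (v : Fin 2 → ℝ) : ℝ :=
  (12 * Q.a * v 0 ^ 2 + 6 * Q.b * v 0 * v 1 + 2 * Q.c * v 1 ^ 2) *
      (2 * Q.c * v 0 ^ 2 + 6 * Q.d * v 0 * v 1 + 12 * Q.e * v 1 ^ 2) -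
    (3 * Q.b * v 0 ^ 2 + 4 * Q.c * v 0 * v 1 + 3 * Q.d * v 1 ^ 2) ^ 2

/-- The quadratic invariant of a binary quartic form. -/
def invI (Q : BinaryQuartic) : ℝ := 12 * Q.a * Q.e - 3 * Q.b * Q.d + Q.c ^ 2

/-- The cubic invariant of a binary quartic form. -/
def invJ (Q : BinaryQuartic) : ℝ :=
  72 * Q.a * Q.c * Q.e + 9 * Q.b * Q.c * Q.d - 27 * Q.a * Q.d ^ 2 - 27 * Q.e * Q.b ^ 2 -
    2 * Q.c ^ 3

/-- The linear substitution `Q ∘ A`. -/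
def subst (Q : BinaryQuartic) (A : Matrix (Fin 2) (Fin 2) ℝ) : BinaryQuartic where
  a := Q.eval ![A 0 0, A 1 0]
  b := Q.dx ![A 0 0, A 1 0] * A 0 1 + Q.dy ![A 0 0, A 1 0] * A 1 1
  c := Q.a * 6 * A 0 0 ^ 2 * A 0 1 ^ 2 +
    Q.b * (3 * A 0 0 ^ 2 * A 0 1 * A 1 1 + 3 * A 0 0 * A 0 1 ^ 2 * A 1 0) +
    Q.c * (A 0 0 ^ 2 * A 1 1 ^ 2 + 4 * A 0 0 * A 0 1 * A 1 0 * A 1 1 + A 0 1 ^ 2 * A 1 0 ^ 2) +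
    Q.d * (3 * A 0 0 * A 1 0 * A 1 1 ^ 2 + 3 * A 0 1 * A 1 0 ^ 2 * A 1 1) +
    Q.e * 6 * A 1 0 ^ 2 * A 1 1 ^ 2
  d := Q.dx ![A 0 1, A 1 1] * A 0 0 + Q.dy ![A 0 1, A 1 1] * A 1 0
  e := Q.eval ![A 0 1, A 1 1]

theorem eval_subst (Q : BinaryQuartic) (A : Matrix (Fin 2) (Fin 2) ℝ) (v : Fin 2 → ℝ) :
    (Q.subst A).eval v = Q.eval (A *ᵥ v) := by
  simp only [eval, subst, dx, dy, Matrix.mulVec, dotProduct, Fin.sum_univ_two, Matrix.cons_val_zero,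
    Matrix.cons_val_one]
  ring

theorem hess_subst (Q : BinaryQuartic) (A : Matrix (Fin 2) (Fin 2) ℝ) (v : Fin 2 → ℝ) :
    (Q.subst A).hess v = A.det ^ 2 * Q.hess (A *ᵥ v) := by
  simp only [eval, subst, dx, dy, hess, Matrix.mulVec, dotProduct, Fin.sum_univ_two,
    Matrix.cons_val_zero, Matrix.cons_val_one, Matrix.det_fin_two]
  ring

theorem invI_subst (Q : BinaryQuartic) (A : Matrix (Fin 2) (Fin 2) ℝ) :
    (Q.subst A).invI = (A.det ^ 2) ^ 2 * Q.invI := by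
  simp only [eval, subst, dx, dy, invI, Matrix.cons_val_zero, Matrix.cons_val_one,
    Matrix.det_fin_two]
  ring

theorem invJ_subst (Q : BinaryQuartic) (A : Matrix (Fin 2) (Fin 2) ℝ) :
    (Q.subst A).invJ = (A.det ^ 2) ^ 3 * Q.invJ := by
  simp only [eval, subst, dx, dy, invJ, Matrix.cons_val_zero, Matrix.cons_val_one,
    Matrix.det_fin_two]
  ring

theorem eval_eq_of_isHomogeneous {P : MvPolynomial (Fin 2) ℝ} (hP : P.IsHomogeneous 4) :
    ∃ Q : BinaryQuartic, ∀ v, MvPolynomial.eval v P = Q.eval v := by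
  let m : ℕ → (Fin 2 →₀ ℕ) := fun i => Finsupp.single 0 i + Finsupp.single 1 (4 - i)
  have hm : Function.Injective m := by
    intro i j hij
    simpa [m] using DFunLike.congr_fun hij 0
  refine ⟨⟨P.coeff (m 4), P.coeff (m 3), P.coeff (m 2), P.coeff (m 1), P.coeff (m 0)⟩, fun v => ?_⟩
  have hsub : P.support ⊆ (Finset.range 5).image m := by
    intro s hs
    have h4 := hP (MvPolynomial.mem_support_iff.1 hs)
    rw [Finsupp.weight_apply, Finsupp.sum_fintype _ _ (by simp)] at h4
    simp only [Pi.one_apply, smul_eq_mul, mul_one, Fin.sum_univ_two] at h4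
    refine Finset.mem_image.2 ⟨s 0, by simp; omega, ?_⟩
    ext i
    fin_cases i
    · simp [m]
    · simp [m]; omega
  rw [MvPolynomial.eval_eq', Finset.sum_subset hsub, Finset.sum_image hm.injOn]
  · simp [Finset.sum_range_succ, m, eval, Fin.prod_univ_two]
    ring
  · intro s _ hs
    simp [MvPolynomial.notMem_support_iff.1 hs]


theorem mul_neg_iff_right {r s : ℝ} (hr : 0 < r) : r * s < 0 ↔ s < 0 :=
  smul_neg_iff_of_pos_left hr

theorem hasFDerivAt_monomial (i j : ℕ) (p : Fin 2 → ℝ) :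
    HasFDerivAt (fun v : Fin 2 → ℝ => v 0 ^ i * v 1 ^ j)
      (p 0 ^ i • ((j • p 1 ^ (j - 1)) • ContinuousLinearMap.proj (R := ℝ) (φ := fun _ => ℝ) 1) +
        p 1 ^ j • ((i • p 0 ^ (i - 1)) • ContinuousLinearMap.proj (R := ℝ) (φ := fun _ => ℝ) 0))
      p := by
  have h0 : HasFDerivAt (fun v : Fin 2 → ℝ => v 0)
    (ContinuousLinearMap.proj (R := ℝ) (φ := fun _ => ℝ) 0) p := hasFDerivAt_apply 0 p
  have h1 : HasFDerivAt (fun v : Fin 2 → ℝ => v 1)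
    (ContinuousLinearMap.proj (R := ℝ) (φ := fun _ => ℝ) 1) p := hasFDerivAt_apply 1 p
  exact (h0.pow i).fun_mul (h1.pow j)

theorem fderiv_eval_apply (Q : BinaryQuartic) (p w : Fin 2 → ℝ) :
    fderiv ℝ Q.eval p w = Q.dx p * w 0 + Q.dy p * w 1 := by
  have key := (((((hasFDerivAt_monomial 4 0 p).const_mul Q.a).fun_add
    ((hasFDerivAt_monomial 3 1 p).const_mul Q.b)).fun_add
    ((hasFDerivAt_monomial 2 2 p).const_mul Q.c)).fun_add
    ((hasFDerivAt_monomial 1 3 p).const_mul Q.d)).fun_add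
    ((hasFDerivAt_monomial 0 4 p).const_mul Q.e)
  have hQ : Q.eval = fun v => Q.a * (v 0 ^ 4 * v 1 ^ 0) + Q.b * (v 0 ^ 3 * v 1 ^ 1) +
      Q.c * (v 0 ^ 2 * v 1 ^ 2) + Q.d * (v 0 ^ 1 * v 1 ^ 3) + Q.e * (v 0 ^ 0 * v 1 ^ 4) := by
    ext v; simp only [eval]; ring
  rw [hQ, key.fderiv]
  simp [dx, dy]
  ring

theorem fderiv_cubic_apply (a b c d : ℝ) (p w : Fin 2 → ℝ) :
    fderiv ℝ (fun v : Fin 2 → ℝ =>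
      a * v 0 ^ 3 + b * v 0 ^ 2 * v 1 + c * v 0 * v 1 ^ 2 + d * v 1 ^ 3) p w =
    (3 * a * p 0 ^ 2 + 2 * b * p 0 * p 1 + c * p 1 ^ 2) * w 0 +
      (b * p 0 ^ 2 + 2 * c * p 0 * p 1 + 3 * d * p 1 ^ 2) * w 1 := by
  have key := ((((hasFDerivAt_monomial 3 0 p).const_mul a).fun_add
    ((hasFDerivAt_monomial 2 1 p).const_mul b)).fun_add
    ((hasFDerivAt_monomial 1 2 p).const_mul c)).fun_add
    ((hasFDerivAt_monomial 0 3 p).const_mul d)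
  have hQ : (fun v : Fin 2 → ℝ =>
      a * v 0 ^ 3 + b * v 0 ^ 2 * v 1 + c * v 0 * v 1 ^ 2 + d * v 1 ^ 3) =
      fun v => a * (v 0 ^ 3 * v 1 ^ 0) + b * (v 0 ^ 2 * v 1 ^ 1) +
      c * (v 0 ^ 1 * v 1 ^ 2) + d * (v 0 ^ 0 * v 1 ^ 3) := by
    ext v; ring
  rw [hQ, key.fderiv]
  simp
  ring

theorem contDiff_eval (Q : BinaryQuartic) : ContDiff ℝ 2 Q.eval := by
  unfold eval
  fun_prop

theorem continuous_eval (Q : BinaryQuartic) : Continuous Q.eval :=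
  Q.contDiff_eval.continuous

theorem continuous_hess (Q : BinaryQuartic) : Continuous Q.hess := by
  unfold hess
  fun_prop

theorem hessDet2_eval (Q : BinaryQuartic) (p : Fin 2 → ℝ) : hessDet2 Q.eval p = Q.hess p := by
  have hdiff : DifferentiableAt ℝ (fderiv ℝ Q.eval) p :=
    ((Q.contDiff_eval.fderiv_right (m := 1) (by norm_num)).differentiable (by norm_num)) p
  have h2 : ∀ v w : Fin 2 → ℝ, iteratedFDeriv ℝ 2 Q.eval p ![v, w] =
      fderiv ℝ (fun z => fderiv ℝ Q.eval z w) p v := by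
    intro v w
    rw [iteratedFDeriv_two_apply, fderiv_clm_apply hdiff (differentiableAt_const w)]
    simp
  have hx : (fun z => fderiv ℝ Q.eval z (Pi.single 0 1)) = fun v : Fin 2 → ℝ =>
      (4 * Q.a) * v 0 ^ 3 + (3 * Q.b) * v 0 ^ 2 * v 1 + (2 * Q.c) * v 0 * v 1 ^ 2 +
        Q.d * v 1 ^ 3 := by
    ext z; rw [fderiv_eval_apply]; simp [dx]
  have hy : (fun z => fderiv ℝ Q.eval z (Pi.single 1 1)) = fun v : Fin 2 → ℝ =>
      Q.b * v 0 ^ 3 + (2 * Q.c) * v 0 ^ 2 * v 1 + (3 * Q.d) * v 0 * v 1 ^ 2 +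
        (4 * Q.e) * v 1 ^ 3 := by
    ext z; rw [fderiv_eval_apply]; simp [dy]
  simp only [hessDet2, Matrix.det_fin_two, Matrix.of_apply, h2, hx, hy, fderiv_cubic_apply]
  simp [hess]
  ring

/-- The hyperbolic points of the level set `Q = 1`. -/
def hyp (Q : BinaryQuartic) : Set (Fin 2 → ℝ) := {p | Q.eval p = 1 ∧ Q.hess p < 0}

/-- The connected component of `p` in the hyperbolic part of the level set `Q = 1`. -/
def comp (Q : BinaryQuartic) (p : Fin 2 → ℝ) : Set (Fin 2 → ℝ) := connectedComponentIn Q.hyp p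

theorem comp_subset (Q : BinaryQuartic) (p : Fin 2 → ℝ) : Q.comp p ⊆ Q.hyp :=
  connectedComponentIn_subset _ _

/-- The homeomorphism of the plane given by an invertible matrix. -/
def mulVecHomeo (A : Matrix (Fin 2) (Fin 2) ℝ) (hA : IsUnit A) : (Fin 2 → ℝ) ≃ₜ (Fin 2 → ℝ) where
  toFun := A.mulVec
  invFun := A⁻¹.mulVec
  left_inv v := by
    rw [Matrix.mulVec_mulVec, Matrix.nonsing_inv_mul _ ((Matrix.isUnit_iff_isUnit_det _).1 hA),
      Matrix.one_mulVec]
  right_inv v := by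
    rw [Matrix.mulVec_mulVec, Matrix.mul_nonsing_inv _ ((Matrix.isUnit_iff_isUnit_det _).1 hA),
      Matrix.one_mulVec]
  continuous_toFun := Continuous.matrix_mulVec continuous_const continuous_id
  continuous_invFun := Continuous.matrix_mulVec continuous_const continuous_id

theorem det_sq_pos {A : Matrix (Fin 2) (Fin 2) ℝ} (hA : IsUnit A) : 0 < A.det ^ 2 := by
  have := ((Matrix.isUnit_iff_isUnit_det _).1 hA).ne_zero
  positivity

theorem mem_hyp_subst {Q : BinaryQuartic} {A : Matrix (Fin 2) (Fin 2) ℝ} (hA : IsUnit A)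
    {p : Fin 2 → ℝ} : p ∈ (Q.subst A).hyp ↔ A *ᵥ p ∈ Q.hyp := by
  have := det_sq_pos hA
  simp only [hyp, Set.mem_ofPred_eq, eval_subst, hess_subst, mul_neg_iff_right this]

theorem image_comp_subst {Q : BinaryQuartic} {A : Matrix (Fin 2) (Fin 2) ℝ} (hA : IsUnit A)
    {p : Fin 2 → ℝ} (hp : p ∈ (Q.subst A).hyp) :
    A.mulVec '' (Q.subst A).comp p = Q.comp (A *ᵥ p) := by
  have h := (mulVecHomeo A hA).image_connectedComponentIn hp
  have himg : mulVecHomeo A hA '' (Q.subst A).hyp = Q.hyp := by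
    ext v
    constructor
    · rintro ⟨w, hw, rfl⟩
      exact (mem_hyp_subst hA).1 hw
    · intro hv
      refine ⟨(mulVecHomeo A hA).symm v, (mem_hyp_subst hA).2 ?_,
        (mulVecHomeo A hA).apply_symm_apply v⟩
      change mulVecHomeo A hA ((mulVecHomeo A hA).symm v) ∈ Q.hyp
      rwa [(mulVecHomeo A hA).apply_symm_apply v]
  rw [himg] at h
  exact h

theorem exists_flex_of_not_isClosed {Q : BinaryQuartic} {p : Fin 2 → ℝ} (hp : p ∈ Q.hyp)
    (hcl : ¬ IsClosed (Q.comp p)) :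
    ∃ e ∈ closure (Q.comp p), Q.eval e = 1 ∧ Q.hess e = 0 := by
  obtain ⟨e, he, hne⟩ : ∃ e ∈ closure (Q.comp p), e ∉ Q.comp p := by
    by_contra! hcon
    exact hcl (isClosed_of_closure_subset hcon)
  have h1 : Q.eval e = 1 :=
    closure_minimal (fun v hv => (Q.comp_subset p hv).1)
      (isClosed_eq Q.continuous_eval continuous_const) he
  have h2 : Q.hess e ≤ 0 :=
    closure_minimal (fun v hv => (Q.comp_subset p hv).2.le)
      (isClosed_le Q.continuous_hess continuous_const) he
  refine ⟨e, he, h1, h2.eq_of_not_lt fun hlt => hne ?_⟩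
  have hpre : IsPreconnected (insert e (Q.comp p)) :=
    isPreconnected_connectedComponentIn.subset_closure (Set.subset_insert _ _)
      (Set.insert_subset he subset_closure)
  have he' : e ∈ Q.hyp := ⟨h1, hlt⟩
  exact hpre.subset_connectedComponentIn
    (Set.mem_insert_of_mem _ (mem_connectedComponentIn hp))
    (Set.insert_subset he' (Q.comp_subset p)) (Set.mem_insert _ _)

/-- The point of the level set `Q = 1` in the direction `(1, t)`. -/
def ray (Q : BinaryQuartic) (t : ℝ) : Fin 2 → ℝ := (Q.eval ![1, t]) ^ (-(1 / 4) : ℝ) • ![1, t]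

theorem eval_smul (Q : BinaryQuartic) (r : ℝ) (v : Fin 2 → ℝ) :
    Q.eval (r • v) = r ^ 4 * Q.eval v := by
  simp [eval]; ring

theorem hess_smul (Q : BinaryQuartic) (r : ℝ) (v : Fin 2 → ℝ) :
    Q.hess (r • v) = r ^ 4 * Q.hess v := by
  simp [hess]; ring

theorem eval_ray {Q : BinaryQuartic} {t : ℝ} (ht : 0 < Q.eval ![1, t]) :
    Q.eval (Q.ray t) = 1 := by
  rw [ray, eval_smul, ← Real.rpow_natCast, ← Real.rpow_mul ht.le]
  norm_num
  rw [Real.rpow_neg_one, inv_mul_cancel₀ ht.ne']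

theorem hess_ray_neg_iff {Q : BinaryQuartic} {t : ℝ} (ht : 0 < Q.eval ![1, t]) :
    Q.hess (Q.ray t) < 0 ↔ Q.hess ![1, t] < 0 := by
  rw [ray, hess_smul, mul_neg_iff_right (by positivity)]

theorem ray_mem_hyp {Q : BinaryQuartic} {t : ℝ} (ht : 0 < Q.eval ![1, t])
    (h : Q.hess ![1, t] < 0) : Q.ray t ∈ Q.hyp :=
  ⟨eval_ray ht, (hess_ray_neg_iff ht).2 h⟩

theorem eq_ray {Q : BinaryQuartic} {v : Fin 2 → ℝ} (hv : 0 < v 0) (h : Q.eval v = 1) :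
    v = Q.ray (v 1 / v 0) := by
  have hv' : v = v 0 • ![1, v 1 / v 0] := by
    ext i
    fin_cases i <;> simp [mul_div_cancel₀, hv.ne']
  have h4 : Q.eval ![1, v 1 / v 0] = (v 0 ^ 4)⁻¹ := by
    have h' := Q.eval_smul (v 0) ![1, v 1 / v 0]
    rw [← hv', h] at h'
    exact eq_inv_of_mul_eq_one_right h'.symm
  have h5 : (v 0 ^ 4)⁻¹ ^ (-(1 / 4) : ℝ) = v 0 := by
    rw [Real.inv_rpow (by positivity), Real.rpow_neg (by positivity), inv_inv,
      ← Real.rpow_natCast, ← Real.rpow_mul hv.le]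
    norm_num
  rw [ray, h4, h5]
  exact hv'

theorem continuousOn_ray {Q : BinaryQuartic} {s : Set ℝ} (hs : ∀ t ∈ s, 0 < Q.eval ![1, t]) :
    ContinuousOn Q.ray s := by
  have h1 : Continuous fun t : ℝ => (![1, t] : Fin 2 → ℝ) := by
    refine continuous_pi fun i => ?_
    fin_cases i
    · exact continuous_const
    · exact continuous_id
  exact ((Q.continuous_eval.comp h1).continuousOn.rpow_const
    fun t ht => Or.inl (hs t ht).ne').smul h1.continuousOn

/-- An arc of directions along which `Q` is positive and hyperbolic lies in one component. -/
theorem ray_image_subset_comp {Q : BinaryQuartic} {s : Set ℝ} (hs : IsPreconnected s)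
    (h0 : ∀ t ∈ s, 0 < Q.eval ![1, t]) (h1 : ∀ t ∈ s, Q.hess ![1, t] < 0) {t₀ : ℝ} (ht₀ : t₀ ∈ s) :
    Q.ray '' s ⊆ Q.comp (Q.ray t₀) :=
  (hs.image _ (continuousOn_ray h0)).subset_connectedComponentIn (Set.mem_image_of_mem _ ht₀)
    (by rintro _ ⟨t, ht, rfl⟩; exact ray_mem_hyp (h0 t ht) (h1 t ht))

theorem subst_subst (Q : BinaryQuartic) (A B : Matrix (Fin 2) (Fin 2) ℝ) :
    (Q.subst A).subst B = Q.subst (A * B) := by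
  ext <;>
  · simp only [eval, subst, dx, dy, Matrix.cons_val_zero, Matrix.cons_val_one, Matrix.mul_apply,
      Fin.sum_univ_two]
    ring

/-- The quartic `x⁴ + b x y³ + c y⁴`, for which `(1, 0)` is a flex of the curve `Q = 1`. -/
def flexForm (b c : ℝ) : BinaryQuartic := ⟨1, 0, 0, b, c⟩

theorem eval_flexForm (b c : ℝ) (v : Fin 2 → ℝ) :
    (flexForm b c).eval v = v 0 ^ 4 + b * v 0 * v 1 ^ 3 + c * v 1 ^ 4 := by
  simp [eval, flexForm]

theorem hess_flexForm (b c : ℝ) (v : Fin 2 → ℝ) :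
    (flexForm b c).hess v =
      9 * (v 1 * (8 * b * v 0 ^ 3 + 16 * c * v 0 ^ 2 * v 1 - b ^ 2 * v 1 ^ 3)) := by
  simp [hess, flexForm]; ring

theorem invI_flexForm (b c : ℝ) : (flexForm b c).invI = 12 * c := by
  simp [invI, flexForm]

theorem invJ_flexForm (b c : ℝ) : (flexForm b c).invJ = -27 * b ^ 2 := by
  simp [invJ, flexForm]

/-- The component of `p` on `flexForm b c = 1` has the flex `(1, 0)` as an end point,
which it approaches from the upper half plane. -/
def EndsAtFlex (b c : ℝ) (p : Fin 2 → ℝ) : Prop :=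
  p ∈ (flexForm b c).hyp ∧ ![1, 0] ∈ closure ((flexForm b c).comp p ∩ {v | 0 < v 1})

theorem exists_subst_eq_flexForm_of_not_isClosed {Q : BinaryQuartic} {p : Fin 2 → ℝ}
    (hp : p ∈ Q.hyp) (hcl : ¬ IsClosed (Q.comp p)) :
    ∃ (A : Matrix (Fin 2) (Fin 2) ℝ) (b c : ℝ) (p' : Fin 2 → ℝ), IsUnit A ∧
      Q.subst A = flexForm b c ∧ A *ᵥ p' = p ∧ ![1, 0] ∈ closure ((flexForm b c).comp p') := by
  obtain ⟨e, he, he1, he0⟩ := exists_flex_of_not_isClosed hp hcl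
  let A : Matrix (Fin 2) (Fin 2) ℝ := !![e 0, -Q.dy e; e 1, Q.dx e]
  have hdet : A.det = 4 := by
    simp only [A, Matrix.det_fin_two_of]
    rw [← mul_one 4, ← he1]
    simp only [eval, dx, dy]
    ring
  have hA : IsUnit A := by rw [Matrix.isUnit_iff_isUnit_det, hdet]; norm_num
  have hcol : ![A 0 0, A 1 0] = e := by
    ext i; fin_cases i <;> rfl
  have hAe : A *ᵥ ![1, 0] = e := by
    ext i; fin_cases i <;> simp [A, Matrix.mulVec, dotProduct]
  have ha : (Q.subst A).a = 1 := by
    simp only [subst, hcol, he1]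
  have hb : (Q.subst A).b = 0 := by
    simp only [subst, hcol]
    simp [A]
    ring
  have hc : (Q.subst A).c = 0 := by
    have h := Q.hess_subst A ![1, 0]
    rw [hAe, he0, hess] at h
    simp [ha, hb] at h
    exact h
  have hN : Q.subst A = flexForm (Q.subst A).d (Q.subst A).e := by
    ext <;> simp [flexForm, ha, hb, hc]
  refine ⟨A, (Q.subst A).d, (Q.subst A).e, (mulVecHomeo A hA).symm p, hA, hN,
    (mulVecHomeo A hA).apply_symm_apply p, ?_⟩
  have hp' : A *ᵥ (mulVecHomeo A hA).symm p = p := (mulVecHomeo A hA).apply_symm_apply p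
  have himg := image_comp_subst hA (p := (mulVecHomeo A hA).symm p)
    ((mem_hyp_subst hA).2 (hp'.symm ▸ hp))
  rw [← hN]
  have h := (mulVecHomeo A hA).image_closure ((Q.subst A).comp ((mulVecHomeo A hA).symm p))
  change _ = closure (A.mulVec '' _) at h
  rw [himg, hp'] at h
  rw [← h] at he
  obtain ⟨w, hw, hwe⟩ := he
  rwa [← (mulVecHomeo A hA).injective (hwe.trans hAe.symm)]

theorem exists_subst_eq_flexForm {Q : BinaryQuartic} {p : Fin 2 → ℝ}
    (hp : p ∈ Q.hyp) (hcl : ¬ IsClosed (Q.comp p)) :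
    ∃ (A : Matrix (Fin 2) (Fin 2) ℝ) (b c : ℝ) (p' : Fin 2 → ℝ), IsUnit A ∧
      Q.subst A = flexForm b c ∧ A *ᵥ p' = p ∧ EndsAtFlex b c p' := by
  obtain ⟨A, b, c, p', hA, hN, hp', hcl'⟩ := exists_subst_eq_flexForm_of_not_isClosed hp hcl
  have hmem : p' ∈ (flexForm b c).hyp := by
    rw [← hN, mem_hyp_subst hA, hp']
    exact hp
  have hsplit : (flexForm b c).comp p' ⊆ ((flexForm b c).comp p' ∩ {v | 0 < v 1}) ∪
      ((flexForm b c).comp p' ∩ {v | v 1 < 0}) := by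
    intro v hv
    rcases lt_trichotomy (v 1) 0 with h | h | h
    · exact Or.inr ⟨hv, h⟩
    · have h2 := (comp_subset _ _ hv).2
      simp [hess_flexForm, h] at h2
    · exact Or.inl ⟨hv, h⟩
  have hcl2 := closure_mono hsplit hcl'
  rw [closure_union] at hcl2
  rcases hcl2 with h | h
  · exact ⟨A, b, c, p', hA, hN, hp', hmem, h⟩
  · let F : Matrix (Fin 2) (Fin 2) ℝ := !![1, 0; 0, -1]
    have hF : IsUnit F := by rw [Matrix.isUnit_iff_isUnit_det]; simp [F, Matrix.det_fin_two_of]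
    have hFF : ∀ v, F *ᵥ (F *ᵥ v) = v := by
      intro v
      ext i; fin_cases i <;> simp [F, Matrix.mulVec, dotProduct]
    have hsub : (flexForm b c).subst F = flexForm (-b) c := by
      ext <;> simp [flexForm, subst, F, eval, dx, dy] <;> ring
    have hsub' : (flexForm (-b) c).subst F = flexForm b c := by
      ext <;> simp [flexForm, subst, F, eval, dx, dy] <;> ring
    have himg : F.mulVec '' (flexForm b c).comp p' = (flexForm (-b) c).comp (F *ᵥ p') := by
      rw [← hsub']
      exact image_comp_subst hF (by rwa [hsub'])
    refine ⟨A * F, -b, c, F *ᵥ p', hA.mul hF, by rw [← subst_subst, hN, hsub], ?_, ?_, ?_⟩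
    · rw [← Matrix.mulVec_mulVec, hFF, hp']
    · rw [← mem_hyp_subst hF, hsub']
      exact hmem
    · have hF0 : F *ᵥ ![1, 0] = ![1, 0] := by
        ext i; fin_cases i <;> simp [F, Matrix.mulVec, dotProduct]
      have hmap := image_closure_subset_closure_image (mulVecHomeo F hF).continuous
        (Set.mem_image_of_mem (mulVecHomeo F hF) h)
      change F *ᵥ ![1, 0] ∈ closure (F.mulVec '' _) at hmap
      rw [hF0] at hmap
      refine closure_mono ?_ hmap
      rintro _ ⟨v, ⟨hv, hv1⟩, rfl⟩
      refine ⟨himg ▸ Set.mem_image_of_mem _ hv, ?_⟩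
      simpa [F, Matrix.mulVec, dotProduct] using hv1

/-- A component ending at the flex contains points in directions arbitrarily close to it. -/
theorem EndsAtFlex.exists_ray_mem {b c : ℝ} {p : Fin 2 → ℝ} (h : EndsAtFlex b c p) {ε : ℝ}
    (hε : 0 < ε) :
    ∃ t ∈ Set.Ioo 0 ε, (flexForm b c).ray t ∈ (flexForm b c).comp p := by
  have hopen : IsOpen {v : Fin 2 → ℝ | 0 < v 0 ∧ v 1 < ε * v 0} :=
    (isOpen_lt continuous_const (continuous_apply 0)).inter
      (isOpen_lt (continuous_apply 1) (continuous_const.mul (continuous_apply 0)))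
  obtain ⟨v, ⟨hv0, hv1⟩, hv, hvpos⟩ := mem_closure_iff.1 h.2 _ hopen (by simp [hε])
  refine ⟨v 1 / v 0, ⟨div_pos hvpos hv0, (div_lt_iff₀ hv0).2 hv1⟩, ?_⟩
  rwa [← eq_ray hv0 (comp_subset _ _ hv).1]

theorem eventually_eval_flexForm_pos (b c : ℝ) :
    ∃ ε > 0, ∀ t ∈ Set.Ioo 0 ε, 0 < (flexForm b c).eval ![1, t] := by
  have hcont : Continuous fun t : ℝ => 1 + b * t ^ 3 + c * t ^ 4 := by fun_prop
  obtain ⟨ε, hε, h⟩ := Metric.isOpen_iff.1 (isOpen_lt continuous_const hcont) 0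
    (show (0 : ℝ) < 1 + b * 0 ^ 3 + c * 0 ^ 4 by norm_num)
  refine ⟨ε, hε, fun t ht => ?_⟩
  have := h (show t ∈ Metric.ball 0 ε by simp [abs_of_pos ht.1, ht.2])
  simpa [eval_flexForm] using this

theorem eventually_hess_flexForm (b c : ℝ) :
    ∃ ε > 0, ∀ t ∈ Set.Ioo 0 ε, ((flexForm b c).hess ![1, t] < 0 ↔ b < 0 ∨ b = 0 ∧ c < 0) := by
  have hG : ∀ t : ℝ, 0 < t → ((flexForm b c).hess ![1, t] < 0 ↔
      8 * b + 16 * c * t - b ^ 2 * t ^ 3 < 0) := by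
    intro t ht
    rw [hess_flexForm, mul_neg_iff_right (by norm_num)]
    simp [mul_neg_iff_right ht]
  have hcont : Continuous fun t : ℝ => 8 * b + 16 * c * t - b ^ 2 * t ^ 3 := by fun_prop
  rcases lt_trichotomy b 0 with hb | hb | hb
  · obtain ⟨ε, hε, h⟩ := Metric.isOpen_iff.1 (isOpen_lt hcont continuous_const) 0
      (show 8 * b + 16 * c * 0 - b ^ 2 * 0 ^ 3 < 0 by linarith)
    refine ⟨ε, hε, fun t ht => ?_⟩
    have := h (show t ∈ Metric.ball 0 ε by simp [abs_of_pos ht.1, ht.2])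
    rw [hG t ht.1]
    exact ⟨fun _ => Or.inl hb, fun _ => this⟩
  · subst hb
    refine ⟨1, one_pos, fun t ht => ?_⟩
    rw [hG t ht.1, show 8 * 0 + 16 * c * t - 0 ^ 2 * t ^ 3 = (16 * t) * c by ring,
      mul_neg_iff_right (by linarith [ht.1])]
    simp
  · obtain ⟨ε, hε, h⟩ := Metric.isOpen_iff.1 (isOpen_lt continuous_const hcont) 0
      (show 0 < 8 * b + 16 * c * 0 - b ^ 2 * 0 ^ 3 by linarith)
    refine ⟨ε, hε, fun t ht => ?_⟩
    have := h (show t ∈ Metric.ball 0 ε by simp [abs_of_pos ht.1, ht.2])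
    rw [hG t ht.1]
    exact ⟨fun h' => absurd h' (lt_asymm this), by rintro (h' | h') <;> linarith⟩

theorem EndsAtFlex.coeff {b c : ℝ} {p : Fin 2 → ℝ} (h : EndsAtFlex b c p) :
    b < 0 ∨ b = 0 ∧ c < 0 := by
  obtain ⟨ε, hε, hε'⟩ := eventually_hess_flexForm b c
  obtain ⟨δ, hδ, hδ'⟩ := eventually_eval_flexForm_pos b c
  obtain ⟨t, ht, hmem⟩ := h.exists_ray_mem (lt_min hε hδ)
  have ht1 : t ∈ Set.Ioo 0 ε := ⟨ht.1, ht.2.trans_le (min_le_left _ _)⟩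
  have ht2 : t ∈ Set.Ioo 0 δ := ⟨ht.1, ht.2.trans_le (min_le_right _ _)⟩
  exact (hε' t ht1).1 ((hess_ray_neg_iff (hδ' t ht2)).1 (comp_subset _ _ hmem).2)

theorem EndsAtFlex.comp_eq {b c : ℝ} {p q : Fin 2 → ℝ} (hp : EndsAtFlex b c p)
    (hq : EndsAtFlex b c q) : (flexForm b c).comp p = (flexForm b c).comp q := by
  obtain ⟨ε, hε, hε'⟩ := eventually_hess_flexForm b c
  obtain ⟨δ, hδ, hδ'⟩ := eventually_eval_flexForm_pos b c
  have hpos : ∀ t ∈ Set.Ioo 0 (min ε δ), 0 < (flexForm b c).eval ![1, t] := fun t ht =>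
    hδ' t ⟨ht.1, ht.2.trans_le (min_le_right _ _)⟩
  have hneg : ∀ t ∈ Set.Ioo 0 (min ε δ), (flexForm b c).hess ![1, t] < 0 := fun t ht =>
    (hε' t ⟨ht.1, ht.2.trans_le (min_le_left _ _)⟩).2 hp.coeff
  obtain ⟨t, ht, htp⟩ := hp.exists_ray_mem (lt_min hε hδ)
  obtain ⟨s, hs, hsq⟩ := hq.exists_ray_mem (lt_min hε hδ)
  have hst := ray_image_subset_comp isPreconnected_Ioo hpos hneg ht (Set.mem_image_of_mem _ hs)
  exact ((connectedComponentIn_eq htp).trans (connectedComponentIn_eq hst)).trans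
    (connectedComponentIn_eq hsq).symm

/-- Non-closed components of hyperbolic level sets are linearly equivalent as soon as the
invariants of the quartics agree up to weighted rescaling. -/
theorem exists_image_comp_eq {Q R : BinaryQuartic} {p q : Fin 2 → ℝ} (hp : p ∈ Q.hyp)
    (hq : q ∈ R.hyp) (hQ : ¬ IsClosed (Q.comp p)) (hR : ¬ IsClosed (R.comp q)) {d : ℝ}
    (hd : 0 < d) (hI : R.invI = d ^ 2 * Q.invI) (hJ : R.invJ = d ^ 3 * Q.invJ) :
    ∃ A : Matrix (Fin 2) (Fin 2) ℝ, IsUnit A ∧ A.mulVec '' Q.comp p = R.comp q := by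
  obtain ⟨A, b, c, p', hA, hQA, rfl, hflex⟩ := exists_subst_eq_flexForm hp hQ
  obtain ⟨B, b', c', q', hB, hRB, rfl, hflex'⟩ := exists_subst_eq_flexForm hq hR
  have hA2 := det_sq_pos hA
  have hB2 := det_sq_pos hB
  obtain ⟨μ, hμ, hμ2⟩ : ∃ μ > 0, μ ^ 2 * A.det ^ 2 = d * B.det ^ 2 :=
    ⟨√(d * B.det ^ 2 / A.det ^ 2), by positivity, by
      rw [Real.sq_sqrt (by positivity), div_mul_cancel₀ _ hA2.ne']⟩
  have hc : c' = μ ^ 4 * c := by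
    have h1 := Q.invI_subst A
    have h2 := R.invI_subst B
    rw [hQA, invI_flexForm] at h1
    rw [hRB, invI_flexForm, hI] at h2
    have h3 : (A.det ^ 2) ^ 2 * (12 * c') = (A.det ^ 2) ^ 2 * (12 * (μ ^ 4 * c)) := by
      rw [h2, mul_left_comm, show 12 * (μ ^ 4 * c) = μ ^ 4 * (12 * c) by ring, h1]
      linear_combination (-(μ ^ 2 * A.det ^ 2 + d * B.det ^ 2) * (A.det ^ 2) ^ 2 * Q.invI) * hμ2
    linarith [mul_left_cancel₀ (by positivity) h3]
  have hb : b' = μ ^ 3 * b := by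
    have h1 := Q.invJ_subst A
    have h2 := R.invJ_subst B
    rw [hQA, invJ_flexForm] at h1
    rw [hRB, invJ_flexForm, hJ] at h2
    have h3 : (A.det ^ 2) ^ 3 * (-27 * b' ^ 2) = (A.det ^ 2) ^ 3 * (-27 * (μ ^ 3 * b) ^ 2) := by
      rw [h2, show -27 * (μ ^ 3 * b) ^ 2 = μ ^ 6 * (-27 * b ^ 2) by ring, h1]
      linear_combination (-((μ ^ 2 * A.det ^ 2) ^ 2 + (μ ^ 2 * A.det ^ 2) * (d * B.det ^ 2) +
        (d * B.det ^ 2) ^ 2) * (A.det ^ 2) ^ 3 * Q.invJ) * hμ2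
    have h4 : b' ^ 2 = (μ ^ 3 * b) ^ 2 := by linarith [mul_left_cancel₀ (by positivity) h3]
    have hb0 : b ≤ 0 := by rcases hflex.coeff with h | h; exacts [h.le, h.1.le]
    have hb0' : b' ≤ 0 := by rcases hflex'.coeff with h | h; exacts [h.le, h.1.le]
    have h5 : μ ^ 3 * b ≤ 0 := mul_nonpos_of_nonneg_of_nonpos (by positivity) hb0
    rcases sq_eq_sq_iff_eq_or_eq_neg.1 h4 with h | h <;> linarith
  let S : Matrix (Fin 2) (Fin 2) ℝ := !![1, 0; 0, μ]
  have hS : IsUnit S := by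
    rw [Matrix.isUnit_iff_isUnit_det]; simp [S, Matrix.det_fin_two_of, hμ.ne']
  have hsub : (flexForm b c).subst S = flexForm b' c' := by
    ext <;> simp [flexForm, subst, S, eval, dx, dy, hb, hc] <;> ring
  let q'' := (mulVecHomeo S hS).symm p'
  have hq'' : S *ᵥ q'' = p' := (mulVecHomeo S hS).apply_symm_apply p'
  have hq''mem : q'' ∈ (flexForm b' c').hyp := by
    rw [← hsub, mem_hyp_subst hS, hq'']
    exact hflex.1
  have himgS : S.mulVec '' (flexForm b' c').comp q'' = (flexForm b c).comp p' := by
    rw [← hq'', ← hsub]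
    exact image_comp_subst hS (by rwa [hsub])
  have hflex'' : EndsAtFlex b' c' q'' := by
    refine ⟨hq''mem, ?_⟩
    have hS0 : S *ᵥ ![1, 0] = ![1, 0] := by
      ext i; fin_cases i <;> simp [S, Matrix.mulVec, dotProduct]
    have h1 := hflex.2
    rw [← himgS] at h1
    have h2 : (flexForm b' c').comp q'' ∩ {v | 0 < v 1} =
        mulVecHomeo S hS ⁻¹' (S.mulVec '' (flexForm b' c').comp q'' ∩ {v | 0 < v 1}) := by
      rw [Set.preimage_inter]
      congr 1
      · exact ((mulVecHomeo S hS).preimage_image _).symm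
      · ext v
        change 0 < v 1 ↔ 0 < (S *ᵥ v) 1
        simp [S, Matrix.mulVec, dotProduct, hμ]
    rw [h2, ← (mulVecHomeo S hS).preimage_closure]
    rw [Set.mem_preimage, show mulVecHomeo S hS ![1, 0] = ![1, 0] from hS0]
    exact h1
  have himgA : A.mulVec '' (flexForm b c).comp p' = Q.comp (A *ᵥ p') := by
    rw [← hQA]; exact image_comp_subst hA (by rw [hQA]; exact hflex.1)
  have himgB : B.mulVec '' (flexForm b' c').comp q' = R.comp (B *ᵥ q') := by
    rw [← hRB]; exact image_comp_subst hB (by rw [hRB]; exact hflex'.1)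
  have hA' : IsUnit (A * S) := hA.mul hS
  refine ⟨B * (A * S)⁻¹, hB.mul ((Matrix.isUnit_nonsing_inv_iff).2 hA'), ?_⟩
  rw [← himgA, ← himgS, ← himgB, hflex'.comp_eq hflex'', Set.image_image, Set.image_image]
  refine Set.image_congr fun v _ => ?_
  rw [Matrix.mulVec_mulVec, Matrix.mulVec_mulVec, Matrix.mul_assoc, Matrix.mul_assoc,
    Matrix.nonsing_inv_mul _ ((Matrix.isUnit_iff_isUnit_det _).1 hA'), Matrix.mul_one]

theorem exists_arc_of_hess_nonneg {Q : BinaryQuartic} (ha : Q.a = 1) (h0 : Q.hess ![1, 0] < 0)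
    {T : ℝ} (hT : 0 ≤ T) (hpos : ∀ t ∈ Set.Icc 0 T, 0 < Q.eval ![1, t])
    (hhess : 0 ≤ Q.hess ![1, T]) :
    (∃ t₀ > 0, ∀ t ∈ Set.Ioo 0 t₀, Q.ray t ∈ Q.comp ![1, 0]) ∧ ¬ IsClosed (Q.comp ![1, 0]) := by
  have hline : Continuous fun t : ℝ => (![1, t] : Fin 2 → ℝ) := by
    refine continuous_pi fun i => ?_
    fin_cases i
    · exact continuous_const
    · exact continuous_id
  have hcomp : IsCompact (Set.Icc 0 T ∩ {t | 0 ≤ Q.hess ![1, t]}) :=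
    isCompact_Icc.inter_right (isClosed_le continuous_const (Q.continuous_hess.comp hline))
  obtain ⟨t₀, ⟨⟨ht0, htT⟩, hth⟩, hmin⟩ := hcomp.exists_isLeast ⟨T, ⟨hT, le_rfl⟩, hhess⟩
  have hth' : 0 ≤ Q.hess ![1, t₀] := hth
  have ht0' : 0 < t₀ := by
    refine ht0.lt_of_ne ?_
    rintro rfl
    exact absurd h0 (not_lt.2 hth')
  have hpos' : ∀ t ∈ Set.Ico 0 t₀, 0 < Q.eval ![1, t] := fun t ht =>
    hpos t ⟨ht.1, ht.2.le.trans htT⟩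
  have hneg : ∀ t ∈ Set.Ico 0 t₀, Q.hess ![1, t] < 0 := by
    intro t ht
    by_contra! hcon
    exact absurd ht.2 (not_lt.2 (hmin ⟨⟨ht.1, ht.2.le.trans htT⟩, hcon⟩))
  have hray0 : Q.ray 0 = ![1, 0] := by
    ext i; fin_cases i <;> simp [ray, eval, ha]
  have hsub := ray_image_subset_comp isPreconnected_Ico hpos' hneg (Set.left_mem_Ico.2 ht0')
  rw [hray0] at hsub
  refine ⟨⟨t₀, ht0', fun t ht => hsub (Set.mem_image_of_mem _ ⟨ht.1.le, ht.2⟩)⟩, fun hcl => ?_⟩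
  have hmem : t₀ ∈ closure (Set.Ico 0 t₀) := by
    rw [closure_Ico ht0'.ne]
    exact ⟨ht0, le_rfl⟩
  have hcont : ContinuousWithinAt Q.ray (Set.Ico 0 t₀) t₀ :=
    ((continuousOn_ray (s := Set.Icc 0 T) hpos) t₀ ⟨ht0, htT⟩).mono
      fun t ht => ⟨ht.1, ht.2.le.trans htT⟩
  have h1 := closure_minimal hsub hcl (hcont.mem_closure_image hmem)
  exact absurd ((hess_ray_neg_iff (hpos t₀ ⟨ht0, htT⟩)).1 (comp_subset _ _ h1).2) (not_lt.2 hth')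

open Polynomial in
theorem eq_of_eval_eq {Q R : BinaryQuartic} {t₀ : ℝ} (ht₀ : 0 < t₀)
    (h : ∀ t ∈ Set.Ioo 0 t₀, Q.eval ![1, t] = R.eval ![1, t]) : Q = R := by
  let P : BinaryQuartic → ℝ[X] := fun Q =>
    C Q.a + C Q.b * X + C Q.c * X ^ 2 + C Q.d * X ^ 3 + C Q.e * X ^ 4
  have hP : P Q = P R := by
    refine Polynomial.eq_of_infinite_eval_eq _ _ ((Set.Ioo_infinite ht₀).mono fun t ht => ?_)
    simpa [P, BinaryQuartic.eval] using h t ht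
  have h0 := congrArg (coeff · 0) hP
  have h1 := congrArg (coeff · 1) hP
  have h2 := congrArg (coeff · 2) hP
  have h3 := congrArg (coeff · 3) hP
  have h4 := congrArg (coeff · 4) hP
  simp [P, coeff_X, coeff_X_pow, coeff_C] at h0 h1 h2 h3 h4
  ext <;> assumption

theorem subst_eq_of_mapsTo {Q R : BinaryQuartic} {p : Fin 2 → ℝ} {B : Matrix (Fin 2) (Fin 2) ℝ}
    (harc : ∃ t₀ > 0, ∀ t ∈ Set.Ioo 0 t₀, Q.ray t ∈ Q.comp p)
    (hB : ∀ v ∈ Q.comp p, R.eval (B *ᵥ v) = 1) : R.subst B = Q := by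
  obtain ⟨t₀, ht₀, harc⟩ := harc
  refine eq_of_eval_eq ht₀ fun t ht => ?_
  have h1 := (comp_subset _ _ (harc t ht)).1
  have h2 := hB _ (harc t ht)
  rw [← eval_subst, ray, eval_smul] at h2
  rw [ray, eval_smul] at h1
  exact mul_left_cancel₀ (left_ne_zero_of_mul_eq_one h1) (h2.trans h1.symm)

theorem invJ_neg_or_of_not_isClosed {Q : BinaryQuartic} {p : Fin 2 → ℝ} (hp : p ∈ Q.hyp)
    (hcl : ¬ IsClosed (Q.comp p)) : Q.invJ < 0 ∨ Q.invJ = 0 ∧ Q.invI < 0 := by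
  obtain ⟨A, b, c, p', hA, hQA, -, hflex⟩ := exists_subst_eq_flexForm hp hcl
  have hA2 := det_sq_pos hA
  have h1 := Q.invI_subst A
  have h2 := Q.invJ_subst A
  rw [hQA, invI_flexForm] at h1
  rw [hQA, invJ_flexForm] at h2
  rcases hflex.coeff with hb | ⟨rfl, hc⟩
  · left
    rw [← mul_neg_iff_right (pow_pos hA2 3), ← h2]
    have := sq_pos_of_neg hb
    linarith
  · right
    constructor
    · simpa [(Matrix.isUnit_iff_isUnit_det _).1 hA |>.ne_zero] using h2.symm
    · rw [← mul_neg_iff_right (pow_pos hA2 2), ← h1]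
      linarith

/-- The quartic `x⁴ - x² y² + L x y³ + K y⁴`. -/
def model (L K : ℝ) : BinaryQuartic := ⟨1, 0, -1, L, K⟩

theorem hLK_eq_eval (L K : ℝ) : hLK L K = (model L K).eval := by
  ext v; simp [hLK, model, eval]; ring

theorem Hcurve_eq_comp (L K : ℝ) : Hcurve L K = (model L K).comp ![1, 0] := by
  simp only [Hcurve, comp, hyp, hLK_eq_eval, hessDet2_eval]

theorem model_mem_hyp (L K : ℝ) : ![1, 0] ∈ (model L K).hyp := by
  constructor <;> norm_num [model, eval, hess]

theorem invI_model (L K : ℝ) : (model L K).invI = 12 * K + 1 := by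
  simp [invI, model]

theorem invJ_model (L K : ℝ) : (model L K).invJ = 2 - 72 * K - 27 * L ^ 2 := by
  simp [invJ, model]; ring

theorem model_zero_arc {K : ℝ} (hK : 1 / 4 < K) :
    (∃ t₀ > 0, ∀ t ∈ Set.Ioo 0 t₀, (model 0 K).ray t ∈ (model 0 K).comp ![1, 0]) ∧
      ¬ IsClosed ((model 0 K).comp ![1, 0]) := by
  have h2 : √2 ^ 2 = (2 : ℝ) := Real.sq_sqrt (by norm_num)
  refine exists_arc_of_hess_nonneg (T := √2) rfl (model_mem_hyp 0 K).2 (Real.sqrt_nonneg _)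
    (fun t _ => ?_) ?_
  · simp only [eval, model, Matrix.cons_val_zero, Matrix.cons_val_one]
    by_cases ht : t = 0
    · simp [ht]
    · have := mul_pos (sub_pos.2 hK) (pow_pos (sq_pos_of_ne_zero ht) 2)
      nlinarith [sq_nonneg (t ^ 2 / 2 - 1)]
  · simp only [hess, model, Matrix.cons_val_zero, Matrix.cons_val_one]
    ring_nf
    rw [show √2 ^ 4 = (√2 ^ 2) ^ 2 by ring, h2]
    linarith

theorem model_one_arc {K : ℝ} (hK : -(25 / 72) ≤ K) :
    (∃ t₀ > 0, ∀ t ∈ Set.Ioo 0 t₀, (model 1 K).ray t ∈ (model 1 K).comp ![1, 0]) ∧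
      ¬ IsClosed ((model 1 K).comp ![1, 0]) := by
  obtain ⟨T, hT0, hT1, hT⟩ : ∃ T : ℝ, 0 < T ∧ T < 1 ∧ T ^ 2 = 9 * T - 6 := by
    have h57 : √57 ^ 2 = (57 : ℝ) := Real.sq_sqrt (by norm_num)
    have hlo : 7 < √57 := Real.lt_sqrt_of_sq_lt (by norm_num)
    have hhi : √57 < 9 := (Real.sqrt_lt' (by norm_num)).2 (by norm_num)
    exact ⟨(9 - √57) / 2, by linarith, by linarith, by linarith⟩
  refine exists_arc_of_hess_nonneg (T := T) rfl (model_mem_hyp 1 K).2 hT0.le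
    (fun t ht => ?_) ?_
  · have ht1 : t ≤ 1 := ht.2.trans hT1.le
    have ht0 : 0 ≤ t := ht.1
    simp only [eval, model, Matrix.cons_val_zero, Matrix.cons_val_one]
    have h1 : 0 ≤ (K + 25 / 72) * t ^ 4 := mul_nonneg (by linarith) (by positivity)
    have h2 : t ^ 4 ≤ t ^ 3 := pow_le_pow_of_le_one ht0 ht1 (by norm_num)
    have h3 : 0 ≤ t ^ 3 := by positivity
    nlinarith [sq_nonneg (3 * t - 2), mul_nonneg ht0 (sq_nonneg (3 * t - 2))]
  · simp only [hess, model, Matrix.cons_val_zero, Matrix.cons_val_one]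
    have hkey : 0 ≤ (K + 25 / 72) * (T ^ 2 * (144 - 24 * T ^ 2)) :=
      mul_nonneg (by linarith) (mul_nonneg (by positivity) (by nlinarith))
    have hzero : (T ^ 2 - 9 * T + 6) ^ 2 = 0 := by rw [hT]; ring
    linarith

theorem Uconst_root : 256 * Uconst ^ 3 - 128 * Uconst ^ 2 - 128 * Uconst - 23 = 0 := by
  have hs : √57 ^ 2 = (57 : ℝ) := Real.sq_sqrt (by norm_num)
  have hz : 0 < 46 + 6 * √57 := by positivity
  obtain ⟨u, hu3, h1, h2⟩ : ∃ u : ℝ, u ^ 3 = (46 - 6 * √57) / 64 ∧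
      (46 + 6 * √57) ^ (-(1 : ℝ) / 3) = u ∧ (46 + 6 * √57) ^ (-(2 : ℝ) / 3) = u ^ 2 := by
    refine ⟨(46 + 6 * √57) ^ (-(1 : ℝ) / 3), ?_, rfl, ?_⟩
    · rw [← Real.rpow_natCast, ← Real.rpow_mul hz.le]
      norm_num
      rw [Real.rpow_neg_one]
      refine (eq_inv_of_mul_eq_one_left ?_).symm
      linear_combination -(36 / 64) * hs
    · rw [← Real.rpow_natCast, ← Real.rpow_mul hz.le]; norm_num
  rw [Uconst, h1, h2]
  generalize √57 = s at *
  have ha : (31 + 3 * s) * u ^ 3 = (25 - 3 * s) / 4 := by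
    rw [hu3]; linear_combination -(18 / 64) * hs
  have hb : (100 + 12 * s) * u ^ 3 = (31 - 3 * s) / 4 := by
    rw [hu3]; linear_combination -(72 / 64) * hs
  have ha3 : (31 + 3 * s) ^ 3 * u ^ 3 = 1261 + 57 * s := by
    linear_combination (31 + 3 * s) ^ 2 * ha + (-27 / 4 * s - 333 / 4) * hs
  have hb3 : (100 + 12 * s) ^ 3 * u ^ 6 = 1261 - 57 * s := by
    linear_combination (100 + 12 * s) * ((100 + 12 * s) * u ^ 3 + (31 - 3 * s) / 4) * hb +
      (108 * s - 1332) / 16 * hs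
  have hab : (31 + 3 * s) * (100 + 12 * s) * u ^ 3 = 112 := by
    linear_combination (31 + 3 * s) * hb - 9 / 4 * hs
  linear_combination (1 / 54) * (ha3 + hb3 + 3 * ((31 + 3 * s) * u + (100 + 12 * s) * u ^ 2) * hab)

theorem le_Uconst_iff (K : ℝ) :
    K ≤ Uconst ↔ 256 * K ^ 3 - 128 * K ^ 2 - 128 * K - 23 ≤ 0 := by
  have hU := Uconst_root
  have hU1 : 21 / 20 < Uconst := by
    by_contra! hcon
    nlinarith [mul_nonneg (sub_nonneg.2 hcon) (sq_nonneg (Uconst + 11 / 40))]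
  have hfac : 256 * K ^ 3 - 128 * K ^ 2 - 128 * K - 23 = (K - Uconst) *
      (256 * (K ^ 2 + K * Uconst + Uconst ^ 2) - 128 * (K + Uconst) - 128) := by
    linear_combination hU
  have hpos : 0 < 256 * (K ^ 2 + K * Uconst + Uconst ^ 2) - 128 * (K + Uconst) - 128 := by
    nlinarith [sq_nonneg (K + Uconst / 2 - 1 / 4)]
  rw [hfac]
  constructor
  · intro h
    exact mul_nonpos_of_nonpos_of_nonneg (by linarith) hpos.le
  · intro h
    by_contra! hcon
    exact absurd h (not_le.2 (mul_pos (by linarith) hpos))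

/-- The parameters of the list of representatives. -/
def IsListed (L K : ℝ) : Prop := L = 0 ∧ 1 / 4 < K ∨ L = 1 ∧ -(25 / 72) ≤ K ∧ K ≤ Uconst

theorem IsListed.arc {L K : ℝ} (h : IsListed L K) :
    (∃ t₀ > 0, ∀ t ∈ Set.Ioo 0 t₀, (model L K).ray t ∈ (model L K).comp ![1, 0]) ∧
      ¬ IsClosed ((model L K).comp ![1, 0]) := by
  rcases h with ⟨rfl, h⟩ | ⟨rfl, h, -⟩
  · exact model_zero_arc h
  · exact model_one_arc h

/-- Invariants `(I, J)` of a quartic with a flex agree, up to weighted rescaling, with those of a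
listed quartic. -/
theorem exists_isListed {I J : ℝ} (h : J < 0 ∨ J = 0 ∧ I < 0) :
    ∃ L K d : ℝ, IsListed L K ∧ 0 < d ∧ I = d ^ 2 * (model L K).invI ∧
      J = d ^ 3 * (model L K).invJ := by
  simp only [invI_model, invJ_model]
  rcases lt_or_ge 0 (4 * I ^ 3 - J ^ 2) with hD | hD
  · have hI : 0 < I := by
      by_contra! hI
      nlinarith [pow_nonneg (neg_nonneg.2 hI) 3, sq_nonneg J]
    have hJ : J < 0 := h.resolve_right fun h' => hI.not_gt h'.2
    obtain ⟨r, hr, hrI⟩ : ∃ r > 0, r ^ 2 = I := ⟨√I, by positivity, Real.sq_sqrt hI.le⟩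
    have hJr : -J < 2 * r ^ 3 := by
      refine lt_of_pow_lt_pow_left₀ 2 (by positivity) ?_
      rw [← hrI] at hD
      linarith
    have hcont : Continuous fun d : ℝ => 6 * I * d - 8 * d ^ 3 := by fun_prop
    obtain ⟨d, ⟨hd0, hdr⟩, hd⟩ := intermediate_value_Ioo (half_pos hr).le hcont.continuousOn
      (show -J ∈ _ from ⟨by simpa using hJ, by rw [← hrI]; linarith⟩)
    simp only at hd
    refine ⟨0, (I / d ^ 2 - 1) / 12, d, Or.inl ⟨rfl, ?_⟩, hd0, ?_, ?_⟩
    · have : 4 < I / d ^ 2 := by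
        rw [lt_div_iff₀ (by positivity), ← hrI]
        nlinarith
      linarith
    · field_simp
      ring
    · field_simp
      linarith
  · obtain ⟨d, hd0, hd⟩ : ∃ d > 0, 6 * I * d + 19 * d ^ 3 = -J := by
      have hcont : Continuous fun d : ℝ => 6 * I * d + 19 * d ^ 3 := by fun_prop
      rcases h with hJ | ⟨rfl, hI⟩
      · let X := 1 + |I| + |J|
        have hX : -J ≤ 6 * I * X + 19 * X ^ 3 := by
          have h1 := neg_abs_le I
          have h2 := neg_abs_le J
          have h3 : 1 ≤ X := by simp only [X]; linarith [abs_nonneg I, abs_nonneg J]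
          have h4 : -J ≤ X := by simp only [X]; linarith [abs_nonneg I]
          have h5 : -I ≤ X := by simp only [X]; linarith [abs_nonneg J]
          have h6 : X ^ 2 ≤ X ^ 3 := pow_le_pow_right₀ h3 (by norm_num)
          nlinarith
        have hX0 : 0 ≤ X := by positivity
        obtain ⟨d, ⟨hd0, -⟩, hd⟩ := intermediate_value_Icc hX0 hcont.continuousOn
          (show -J ∈ _ from ⟨by simpa using hJ.le, hX⟩)
        refine ⟨d, hd0.lt_of_ne ?_, hd⟩
        rintro rfl
        simp at hd
        exact hJ.ne hd
      · refine ⟨√(-6 * I / 19), Real.sqrt_pos.2 (by linarith), ?_⟩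
        have := Real.sq_sqrt (show 0 ≤ -6 * I / 19 by linarith)
        linear_combination 19 * √(-6 * I / 19) * this
    have hJ : J ≤ 0 := by rcases h with h | h; exacts [h.le, h.1.le]
    have hI' : I = d ^ 2 * (12 * ((I / d ^ 2 - 1) / 12) + 1) := by
      field_simp
      ring
    have hJ' : J = d ^ 3 * (2 - 72 * ((I / d ^ 2 - 1) / 12) - 27 * 1 ^ 2) := by
      field_simp
      linarith
    refine ⟨1, (I / d ^ 2 - 1) / 12, d, Or.inr ⟨rfl, ?_, ?_⟩, hd0, hI', hJ'⟩
    · generalize (I / d ^ 2 - 1) / 12 = K at *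
      by_contra! hK
      have := mul_pos (pow_pos hd0 3) (show 0 < 2 - 72 * K - 27 * 1 ^ 2 by linarith)
      linarith
    · generalize (I / d ^ 2 - 1) / 12 = K at *
      rw [le_Uconst_iff]
      rw [hI', hJ'] at hD
      by_contra! hK
      have := mul_pos (pow_pos hd0 6) hK
      linarith

theorem IsListed.eq_of_inv {L K L' K' d : ℝ} (h : IsListed L K) (h' : IsListed L' K')
    (hd : 0 < d) (hI : (model L' K').invI = d ^ 2 * (model L K).invI)
    (hJ : (model L' K').invJ = d ^ 3 * (model L K).invJ) : L = L' ∧ K = K' := by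
  have hdisc : 4 * (model L' K').invI ^ 3 - (model L' K').invJ ^ 2 =
      d ^ 6 * (4 * (model L K).invI ^ 3 - (model L K).invJ ^ 2) := by
    rw [hI, hJ]; ring
  have hposdisc : ∀ K : ℝ, 1 / 4 < K → 0 < 4 * (model 0 K).invI ^ 3 - (model 0 K).invJ ^ 2 := by
    intro K hK
    rw [invI_model, invJ_model]
    have := mul_pos (show 0 < 432 * K by linarith) (pow_pos (show 0 < 4 * K - 1 by linarith) 2)
    linarith
  have hnegdisc : ∀ K : ℝ, K ≤ Uconst → 4 * (model 1 K).invI ^ 3 - (model 1 K).invJ ^ 2 ≤ 0 := by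
    intro K hK
    rw [invI_model, invJ_model]
    have := (le_Uconst_iff K).1 hK
    linarith
  have hd6 : 0 < d ^ 6 := by positivity
  rcases h with ⟨rfl, hK⟩ | ⟨rfl, hK, hKU⟩ <;> rcases h' with ⟨rfl, hK'⟩ | ⟨rfl, hK', hKU'⟩
  · refine ⟨rfl, ?_⟩
    rw [invI_model, invI_model] at hI
    rw [invJ_model, invJ_model] at hJ
    have hkey : (d - 1) * (6 * (12 * K + 1) * d ^ 2 - 8 * (1 + d + d ^ 2)) = 0 := by
      linear_combination 6 * hI + hJ
    rcases mul_eq_zero.1 hkey with h1 | h1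
    · have : d = 1 := by linarith
      subst this
      linarith
    · have h2 : 1 < d := by nlinarith
      nlinarith [mul_pos (pow_pos hd 2) (show 0 < K - 1 / 4 by linarith)]
  · exact absurd hdisc (((hnegdisc K' hKU').trans_lt (mul_pos hd6 (hposdisc K hK))).ne)
  · exact absurd hdisc
      ((mul_nonpos_of_nonneg_of_nonpos hd6.le (hnegdisc K hKU)).trans_lt (hposdisc K' hK')).ne'
  · refine ⟨rfl, ?_⟩
    rw [invI_model, invI_model] at hI
    rw [invJ_model, invJ_model] at hJ
    have hkey : (d - 1) * (6 * (12 * K + 1) * d ^ 2 + 19 * (1 + d + d ^ 2)) = 0 := by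
      linear_combination 6 * hI + hJ
    rcases mul_eq_zero.1 hkey with h1 | h1
    · have : d = 1 := by linarith
      subst this
      linarith
    · nlinarith [pow_pos hd 2]

end BinaryQuartic

/-- **Classification of maximal non-closed (incomplete) quartic GPSR curves.**
If the connected component `H` (through a hyperbolic point `p₀` of a homogeneous quartic
polynomial `h` with `h p₀ = 1`) of the hyperbolic level set is not closed, then there is
exactly one curve `M` from the list `H_{0,K}` (`K > 1/4`) and `H_{1,K}` (`K ∈ [−25/72, U]`)
that is mapped onto `H` by some linear transformation `A ∈ GL(2,ℝ)`. -/
theorem incomplete_quartic_GPSR_curve_classification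
    (h : (Fin 2 → ℝ) → ℝ)
    (hpoly : ∃ P : MvPolynomial (Fin 2) ℝ, P.IsHomogeneous 4 ∧
      h = fun v => MvPolynomial.eval v P)
    (p₀ : Fin 2 → ℝ) (hp₀1 : h p₀ = 1) (hp₀hyp : hessDet2 h p₀ < 0)
    (H : Set (Fin 2 → ℝ))
    (hH : H = connectedComponentIn {p | h p = 1 ∧ hessDet2 h p < 0} p₀)
    (hnotclosed : ¬ IsClosed H) :
    ∃! M : Set (Fin 2 → ℝ),
      ((∃ K : ℝ, 1/4 < K ∧ M = Hcurve 0 K) ∨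
        (∃ K : ℝ, -(25/72) ≤ K ∧ K ≤ Uconst ∧ M = Hcurve 1 K)) ∧
      ∃ A : Matrix (Fin 2) (Fin 2) ℝ, IsUnit A ∧ A.mulVec '' M = H := by
  obtain ⟨P, hP, rfl⟩ := hpoly
  obtain ⟨Q, hQ⟩ := BinaryQuartic.eval_eq_of_isHomogeneous hP
  rw [show (fun v => MvPolynomial.eval v P) = Q.eval from funext hQ] at hp₀1 hp₀hyp hH
  simp only [BinaryQuartic.hessDet2_eval] at hp₀hyp hH
  have hp : p₀ ∈ Q.hyp := ⟨hp₀1, hp₀hyp⟩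
  change H = Q.comp p₀ at hH
  subst hH
  have hlist : ∀ M : Set (Fin 2 → ℝ), ((∃ K : ℝ, 1/4 < K ∧ M = Hcurve 0 K) ∨
        (∃ K : ℝ, -(25/72) ≤ K ∧ K ≤ Uconst ∧ M = Hcurve 1 K)) ↔
      ∃ L K : ℝ, BinaryQuartic.IsListed L K ∧ M = (BinaryQuartic.model L K).comp ![1, 0] := by
    intro M
    simp only [BinaryQuartic.Hcurve_eq_comp]
    constructor
    · rintro (⟨K, hK, rfl⟩ | ⟨K, hK, hU, rfl⟩)
      · exact ⟨0, K, Or.inl ⟨rfl, hK⟩, rfl⟩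
      · exact ⟨1, K, Or.inr ⟨rfl, hK, hU⟩, rfl⟩
    · rintro ⟨_, K, ⟨rfl, hK⟩ | ⟨rfl, hK, hU⟩, rfl⟩
      · exact Or.inl ⟨K, hK, rfl⟩
      · exact Or.inr ⟨K, hK, hU, rfl⟩
  obtain ⟨L, K, d, hLK, hd, hI, hJ⟩ :=
    BinaryQuartic.exists_isListed (BinaryQuartic.invJ_neg_or_of_not_isClosed hp hnotclosed)
  obtain ⟨A, hA, hAM⟩ := BinaryQuartic.exists_image_comp_eq (BinaryQuartic.model_mem_hyp L K) hp
    hLK.arc.2 hnotclosed hd hI hJ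
  refine ⟨_, ⟨(hlist _).2 ⟨L, K, hLK, rfl⟩, A, hA, hAM⟩, ?_⟩
  rintro M' ⟨hM', A', hA', hAM'⟩
  obtain ⟨L', K', hLK', rfl⟩ := (hlist _).1 hM'
  have hdet' := (Matrix.isUnit_iff_isUnit_det _).1 hA'
  have hB : IsUnit (A'⁻¹ * A) := (Matrix.isUnit_nonsing_inv_iff.2 hA').mul hA
  have hsub := BinaryQuartic.subst_eq_of_mapsTo (R := BinaryQuartic.model L' K')
    (B := A'⁻¹ * A) hLK.arc.1 fun v hv => by
      obtain ⟨w, hw, hwv⟩ : A *ᵥ v ∈ A'.mulVec '' _ := by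
        rw [hAM', ← hAM]
        exact Set.mem_image_of_mem _ hv
      rw [← Matrix.mulVec_mulVec, ← hwv, Matrix.mulVec_mulVec, Matrix.nonsing_inv_mul _ hdet',
        Matrix.one_mulVec]
      exact (BinaryQuartic.comp_subset _ _ hw).1
  have hI' := (BinaryQuartic.model L' K').invI_subst (A'⁻¹ * A)
  have hJ' := (BinaryQuartic.model L' K').invJ_subst (A'⁻¹ * A)
  rw [hsub] at hI' hJ'
  obtain ⟨rfl, rfl⟩ := hLK'.eq_of_inv hLK (BinaryQuartic.det_sq_pos hB) hI' hJ'
  rfl
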